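/- Let s and t be coprime positive integers and n, m integers with 0 < n < s and 0 < m < t. For every τ ∈ ℂ with Im τ > 0 (writing q^x := exp(2πiτx)), the limit of q^{((ms)²+(nt)²)/(4st) − N/2} · 𝒥′_N(q) + (3N²/4) · Φ_{s,t}^{(s−n,m)}(τ), as N → ∞ through even positive integers, equals Σ_{k∈ℤ} k(k+1) ( q^{(2stk+st−nt−ms)²/(4st)} − q^{(2stk+st−nt+ms)²/(4st)} ). (The right-hand side is η(τ)·ch_q 𝒳_{n,m}^−, the character of the irreducible (s,t)-log VOA module 𝒳_{n,m}^−.) -/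

import Mathlib

open Complex Finset Filter

/-- `Q τ x = q^x = exp(2πiτx)` for real `x`. -/
noncomputable def Q (τ : ℂ) (x : ℝ) : ℂ := Complex.exp (2 * Real.pi * Complex.I * τ * x)

/-- The 2st-periodic function `χ_{a,b} = χ_{2st}^{(a,b)}`. -/
def chi (s t a b k : ℤ) : ℤ :=
  if k ≡ a * t - b * s [ZMOD 2 * s * t] ∨ k ≡ -(a * t - b * s) [ZMOD 2 * s * t] then 1
  else if k ≡ a * t + b * s [ZMOD 2 * s * t] ∨ k ≡ -(a * t + b * s) [ZMOD 2 * s * t] then -1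
  else 0

/-- The theta series `Φ_{s,t}^{(a,b)}(τ)`. -/
noncomputable def Phi (s t a b : ℤ) (τ : ℂ) : ℂ :=
  (1 / 2) * ∑' k : ℤ, (chi s t a b k : ℂ) * Q τ ((k : ℝ) ^ 2 / (4 * s * t))

/-- The family `𝒥'_N(q; (n,m), 3s, 3t)` of colored Jones polynomials of `T_{3s,3t}`;
the inner index `r` runs over `-c/2, -c/2 + 1, …, c/2`, realized as `r = (2j - c)/2`
for `j = 0, 1, …, c`. -/
noncomputable def J' (s t n m : ℤ) (N : ℕ) (τ : ℂ) : ℂ :=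
  (Q τ ((N : ℝ) / 2) - Q τ (-((N : ℝ) / 2)))⁻¹ *
    ∑ b ∈ Finset.range N,
      ∑ c ∈ (Finset.Icc |2 * (b : ℤ) - N + 1| (2 * b + N - 1)).filter (fun c : ℤ => Odd (c + N)),
        ∑ j ∈ Finset.range (c.toNat + 1),
          (fun r : ℝ =>
            Q τ (((s * t : ℤ) : ℝ) * r ^ 2 - ((m * s + n * t : ℤ) : ℝ) * r
                + ((m * n : ℤ) : ℝ) / 2)
              - Q τ (((s * t : ℤ) : ℝ) * r ^ 2 - ((m * s - n * t : ℤ) : ℝ) * r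
                - ((m * n : ℤ) : ℝ) / 2))
          (((2 * (j : ℤ) - c : ℤ) : ℝ) / 2)


/-- Theta term with shift `a`. -/
noncomputable def thA (s t a : ℤ) (τ : ℂ) (k : ℤ) : ℂ :=
  Q τ (((2 * s * t * k + a : ℤ) : ℝ) ^ 2 / (4 * s * t))

lemma norm_Q (τ : ℂ) (x : ℝ) : ‖Q τ x‖ = Real.exp (-(2 * Real.pi * τ.im * x)) := by
  unfold Q
  rw [Complex.norm_exp]
  congr 1
  simp

lemma Q_add (τ : ℂ) (x y : ℝ) : Q τ (x + y) = Q τ x * Q τ y := by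
  unfold Q
  rw [← Complex.exp_add]
  congr 1
  push_cast
  ring

lemma summable_thA_norm (s t a : ℤ) (hs : 0 < s) (ht : 0 < t) (τ : ℂ) (hτ : 0 < τ.im) :
    Summable (fun k : ℤ => ((2 * (k : ℝ) + 1) ^ 2) * ‖thA s t a τ k‖) := by
  have hs' : (0 : ℝ) < s := by exact_mod_cast hs
  have ht' : (0 : ℝ) < t := by exact_mod_cast ht
  have hT : 0 < 2 * τ.im * s * t := by positivity
  have h2 := summable_pow_mul_jacobiTheta₂_term_bound (τ.im * |(a : ℝ)|) hT 2
  have h0 := summable_pow_mul_jacobiTheta₂_term_bound (τ.im * |(a : ℝ)|) hT 0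
  refine Summable.of_nonneg_of_le (fun k => by positivity) (fun k => ?_)
    ((h2.mul_left 8).add (h0.mul_left 2))
  rw [thA, norm_Q]
  have hE : Real.exp (-(2 * Real.pi * τ.im * (((2 * s * t * k + a : ℤ) : ℝ) ^ 2 / (4 * s * t))))
      ≤ Real.exp (-Real.pi * (2 * τ.im * s * t * (k : ℝ) ^ 2
          - 2 * (τ.im * |(a : ℝ)|) * |(k : ℝ)|)) := by
    apply Real.exp_le_exp.mpr
    have h1 : ((2 * s * t * k + a : ℤ) : ℝ) ^ 2 / (4 * s * t)
        = s * t * (k : ℝ) ^ 2 + a * k + (a : ℝ) ^ 2 / (4 * s * t) := by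
      push_cast
      field_simp
      ring
    have h3 : 0 ≤ (a : ℝ) ^ 2 / (4 * s * t) := by positivity
    have h4 : -(|(a : ℝ)| * |(k : ℝ)|) ≤ a * k := by
      rw [← abs_mul]; exact neg_abs_le _
    have h5 : s * t * (k : ℝ) ^ 2 - |(a : ℝ)| * |(k : ℝ)|
        ≤ ((2 * s * t * k + a : ℤ) : ℝ) ^ 2 / (4 * s * t) := by rw [h1]; linarith
    have h6 := mul_le_mul_of_nonneg_left h5 (by positivity : 0 ≤ 2 * Real.pi * τ.im)
    linarith
  have hk : (2 * (k : ℝ) + 1) ^ 2 ≤ 8 * (k : ℝ) ^ 2 + 2 := by nlinarith [sq_nonneg (2 * (k : ℝ) - 1)]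
  calc _ ≤ (8 * (k : ℝ) ^ 2 + 2) * _ := mul_le_mul hk hE (by positivity) (by positivity)
    _ = _ := by
      push_cast
      rw [sq_abs, pow_zero]
      ring

lemma summable_mul_thA (s t a : ℤ) (hs : 0 < s) (ht : 0 < t) (τ : ℂ) (hτ : 0 < τ.im)
    (f : ℤ → ℂ) (hf : ∀ k : ℤ, ‖f k‖ ≤ (2 * (k : ℝ) + 1) ^ 2) :
    Summable (fun k : ℤ => f k * thA s t a τ k) := by
  refine Summable.of_norm_bounded (summable_thA_norm s t a hs ht τ hτ) (fun k => ?_)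
  rw [norm_mul]
  exact mul_le_mul_of_nonneg_right (hf k) (norm_nonneg _)

lemma one_le_odd_sq (k : ℤ) : (1 : ℝ) ≤ (2 * (k : ℝ) + 1) ^ 2 := by
  have : (1 : ℤ) ≤ (2 * k + 1) ^ 2 := by
    have : 0 ≤ k * (k + 1) := by
      rcases le_or_gt 0 k with h | h
      · positivity
      · nlinarith
    nlinarith
  exact_mod_cast this

lemma norm_kk (k : ℤ) : ‖(k : ℂ) * ((k : ℂ) + 1)‖ ≤ (2 * (k : ℝ) + 1) ^ 2 := by
  have : (k : ℂ) * ((k : ℂ) + 1) = (((k : ℝ) * ((k : ℝ) + 1) : ℝ) : ℂ) := by push_cast; ring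
  rw [this, Complex.norm_real, Real.norm_eq_abs, abs_le]
  constructor <;> nlinarith [sq_nonneg (2 * (k : ℝ) + 1), one_le_odd_sq k]

/-- Reflection of the second theta term. -/
lemma tsum_reflect (A B f : ℤ → ℂ) (hf : ∀ k, f (-1 - k) = f k)
    (hA : Summable fun k => f k * A k) (hB : Summable fun k => f k * B k) :
    ∑' k, f k * (A k - B (-1 - k)) = ∑' k, f k * (A k - B k) := by
  have hB' : Summable fun k => f k * B (-1 - k) := by
    have := (Equiv.subLeft (-1 : ℤ)).summable_iff.mpr hB
    refine this.congr (fun k => ?_)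
    simp [hf]
  have e : ∑' k, f k * B (-1 - k) = ∑' k, f k * B k := by
    rw [← (Equiv.subLeft (-1 : ℤ)).tsum_eq (fun k => f k * B k)]
    exact tsum_congr (fun k => by simp [hf])
  simp only [mul_sub]
  rw [hA.tsum_sub hB', hA.tsum_sub hB, e]

lemma hasSum_class (s t a : ℤ) (hs : 0 < s) (ht : 0 < t) (τ : ℂ) (hτ : 0 < τ.im) :
    HasSum (fun k : ℤ => (if k ≡ a [ZMOD 2 * s * t] then (1 : ℂ) else 0)
      * Q τ ((k : ℝ) ^ 2 / (4 * s * t))) (∑' k, thA s t a τ k) := by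
  have hsum : Summable (thA s t a τ) := by
    simpa using summable_mul_thA s t a hs ht τ hτ (fun _ => 1)
      (fun k => by simpa using one_le_odd_sq k)
  have hinj : Function.Injective (fun k : ℤ => 2 * s * t * k + a) := by
    intro x y h
    have h0 : 2 * s * t ≠ 0 := by positivity
    simpa [hs.ne', ht.ne'] using h
  rw [← hinj.hasSum_iff]
  · convert hsum.hasSum using 1
    funext k
    have : 2 * s * t * k + a ≡ a [ZMOD 2 * s * t] := by
      simp [Int.ModEq]
    simp [this, thA]
  · intro x hx
    have : ¬ x ≡ a [ZMOD 2 * s * t] := by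
      intro h
      apply hx
      obtain ⟨c, hc⟩ := h.symm.dvd
      exact ⟨c, by simp only; linarith⟩
    simp [this]

lemma tsum_thA_neg (s t a : ℤ) (τ : ℂ) : ∑' k, thA s t (-a) τ k = ∑' k, thA s t a τ k := by
  rw [← (Equiv.neg ℤ).tsum_eq]
  refine tsum_congr (fun k => ?_)
  unfold thA
  congr 2
  push_cast [Equiv.neg_apply]
  ring

lemma chi_eq (s t n m : ℤ) (hs : 0 < s) (ht : 0 < t) (hst : IsCoprime s t)
    (hn : 0 < n) (hns : n < s) (hm : 0 < m) (hmt : m < t) (k : ℤ) :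
    (chi s t (s - n) m k : ℂ) =
      (if k ≡ s * t - n * t - m * s [ZMOD 2 * s * t] then (1 : ℂ) else 0)
      + (if k ≡ -(s * t - n * t - m * s) [ZMOD 2 * s * t] then (1 : ℂ) else 0)
      - (if k ≡ s * t - n * t + m * s [ZMOD 2 * s * t] then (1 : ℂ) else 0)
      - (if k ≡ -(s * t - n * t + m * s) [ZMOD 2 * s * t] then (1 : ℂ) else 0) := by
  have e1 : (s - n) * t - m * s = s * t - n * t - m * s := by ring
  have e2 : (s - n) * t + m * s = s * t - n * t + m * s := by ring
  have hsn : ¬ s ∣ n := fun h => by have := Int.le_of_dvd hn h; omega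
  have htm : ¬ t ∣ m := fun h => by have := Int.le_of_dvd hm h; omega
  -- the classes are pairwise distinct
  have d12 : k ≡ s * t - n * t - m * s [ZMOD 2 * s * t] →
      ¬ k ≡ -(s * t - n * t - m * s) [ZMOD 2 * s * t] := by
    intro h1 h2
    obtain ⟨c, hc⟩ := (h1.symm.trans h2).dvd
    apply hsn
    have : s ∣ n * t := ⟨t * c + t - m, by linarith⟩
    exact hst.dvd_of_dvd_mul_right this
  have d34 : k ≡ s * t - n * t + m * s [ZMOD 2 * s * t] →
      ¬ k ≡ -(s * t - n * t + m * s) [ZMOD 2 * s * t] := by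
    intro h1 h2
    obtain ⟨c, hc⟩ := (h1.symm.trans h2).dvd
    apply hsn
    have : s ∣ n * t := ⟨t * c + t + m, by linarith⟩
    exact hst.dvd_of_dvd_mul_right this
  have d13 : k ≡ s * t - n * t - m * s [ZMOD 2 * s * t] →
      ¬ k ≡ s * t - n * t + m * s [ZMOD 2 * s * t] := by
    intro h1 h2
    obtain ⟨c, hc⟩ := (h1.symm.trans h2).dvd
    apply htm
    refine ⟨c, mul_left_cancel₀ hs.ne' (by linarith)⟩
  have d24 : k ≡ -(s * t - n * t - m * s) [ZMOD 2 * s * t] →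
      ¬ k ≡ -(s * t - n * t + m * s) [ZMOD 2 * s * t] := by
    intro h1 h2
    obtain ⟨c, hc⟩ := (h1.symm.trans h2).dvd
    apply htm
    refine ⟨-c, mul_left_cancel₀ hs.ne' (by linarith)⟩
  have d14 : k ≡ s * t - n * t - m * s [ZMOD 2 * s * t] →
      ¬ k ≡ -(s * t - n * t + m * s) [ZMOD 2 * s * t] := by
    intro h1 h2
    obtain ⟨c, hc⟩ := (h1.symm.trans h2).dvd
    apply hsn
    refine ⟨c + 1, mul_left_cancel₀ ht.ne' (by linarith)⟩
  have d23 : k ≡ -(s * t - n * t - m * s) [ZMOD 2 * s * t] →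
      ¬ k ≡ s * t - n * t + m * s [ZMOD 2 * s * t] := by
    intro h1 h2
    obtain ⟨c, hc⟩ := (h1.symm.trans h2).dvd
    apply hsn
    refine ⟨1 - c, mul_left_cancel₀ ht.ne' (by linarith)⟩
  unfold chi
  rw [e1, e2]
  by_cases h1 : k ≡ s * t - n * t - m * s [ZMOD 2 * s * t]
  · simp only [h1, d12 h1, d13 h1, d14 h1]; simp
  by_cases h2 : k ≡ -(s * t - n * t - m * s) [ZMOD 2 * s * t]
  · simp only [h1, h2, d23 h2, d24 h2]; simp
  by_cases h3 : k ≡ s * t - n * t + m * s [ZMOD 2 * s * t]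
  · simp only [h1, h2, h3, d34 h3]; simp
  by_cases h4 : k ≡ -(s * t - n * t + m * s) [ZMOD 2 * s * t]
  · simp only [h1, h2, h3, h4]; simp
  · simp only [h1, h2, h3, h4]; simp

lemma Phi_eq (s t n m : ℤ) (hs : 0 < s) (ht : 0 < t) (hst : IsCoprime s t)
    (hn : 0 < n) (hns : n < s) (hm : 0 < m) (hmt : m < t) (τ : ℂ) (hτ : 0 < τ.im) :
    Phi s t (s - n) m τ = ∑' k, thA s t (s * t - n * t - m * s) τ k
      - ∑' k, thA s t (s * t - n * t + m * s) τ k := by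
  have h1 := hasSum_class s t (s * t - n * t - m * s) hs ht τ hτ
  have h2 := hasSum_class s t (-(s * t - n * t - m * s)) hs ht τ hτ
  have h3 := hasSum_class s t (s * t - n * t + m * s) hs ht τ hτ
  have h4 := hasSum_class s t (-(s * t - n * t + m * s)) hs ht τ hτ
  rw [tsum_thA_neg] at h2 h4
  have h := ((h1.add h2).sub h3).sub h4
  unfold Phi
  have h' := h.tsum_eq
  rw [tsum_congr fun k : ℤ => by
    rw [chi_eq s t n m hs ht hst hn hns hm hmt k, sub_mul, sub_mul, add_mul], h']
  ring

/-- Indicator of `-(x+1) ≤ k < x+1`. -/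
def ind (x k : ℤ) : ℤ := if -(x + 1) ≤ k ∧ k < x + 1 then 1 else 0

/-- The weight with which index `k` occurs. -/
noncomputable def wt (M : ℕ) (k : ℤ) : ℤ :=
  ∑ b ∈ Finset.range (2 * M), ∑ x ∈ Finset.Ico (max ((b : ℤ) - M) (M - 1 - b)) (b + M), ind x k

lemma ind_le_one (x k : ℤ) : ind x k ≤ 1 := by unfold ind; split_ifs <;> simp
lemma ind_nonneg (x k : ℤ) : 0 ≤ ind x k := by unfold ind; split_ifs <;> simp

lemma wt_nonneg (M : ℕ) (k : ℤ) : 0 ≤ wt M k :=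
  Finset.sum_nonneg fun _ _ => Finset.sum_nonneg fun _ _ => ind_nonneg _ _

lemma wt_le (M : ℕ) (k : ℤ) : wt M k ≤ 6 * M ^ 2 := by
  unfold wt
  calc _ ≤ ∑ b ∈ Finset.range (2 * M), (3 * M : ℤ) := by
        refine Finset.sum_le_sum fun b hb => ?_
        have hb := Finset.mem_range.mp hb
        refine (Finset.sum_le_sum fun x _ => ind_le_one x k).trans ?_
        simp only [Finset.sum_const, Int.card_Ico, nsmul_eq_mul, mul_one]
        omega
    _ = _ := by simp; ring

lemma sum_ind (l u p k : ℤ) (hp : p = max k (-1 - k)) (hl : l ≤ u) (hpu : p ≤ u) :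
    ∑ x ∈ Finset.Ico l u, ind x k = u - max p l := by
  have : ∀ x, ind x k = if p ≤ x then 1 else 0 := by
    intro x; unfold ind; congr 1; apply propext; omega
  simp only [this]
  rw [← Finset.sum_filter]
  have e : (Finset.Ico l u).filter (fun x => p ≤ x) = Finset.Ico (max p l) u := by
    ext x; simp only [Finset.mem_filter, Finset.mem_Ico]; omega
  rw [e]
  simp only [Finset.sum_const, Int.card_Ico, nsmul_eq_mul, mul_one]
  omega

lemma sum_max (M p : ℕ) (hp : p < M) :
    2 * ∑ i ∈ Finset.range M, max (p : ℤ) i = M * (M - 1) + p * (p + 1) := by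
  induction M, hp using Nat.le_induction with
  | base =>
    have : ∀ i ∈ Finset.range (p + 1), max (p : ℤ) i = p := by
      intro i hi; have := Finset.mem_range.mp hi; omega
    rw [Nat.succ_eq_add_one, Finset.sum_congr rfl this]
    simp; ring
  | succ M hM ih =>
    rw [Finset.sum_range_succ, mul_add, ih]
    have : max (p : ℤ) M = M := by omega
    rw [this]; push_cast; ring

lemma wt_eq (M : ℕ) (k : ℤ) (h1 : -(M : ℤ) ≤ k) (h2 : k < M) :
    wt M k = 3 * M ^ 2 - k * (k + 1) := by
  obtain ⟨p, hp⟩ : ∃ p : ℕ, (p : ℤ) = max k (-1 - k) := ⟨(max k (-1 - k)).toNat, by omega⟩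
  have hpM : p < M := by omega
  have hpp : k * (k + 1) = p * (p + 1) := by
    rcases le_or_gt 0 k with h | h
    · have : (p : ℤ) = k := by omega
      rw [this]
    · have : (p : ℤ) = -1 - k := by omega
      rw [this]; ring
  have hin : ∀ b ∈ Finset.range (2 * M),
      ∑ x ∈ Finset.Ico (max ((b : ℤ) - M) (M - 1 - b)) (b + M), ind x k
      = (b + M) - max (p : ℤ) (max ((b : ℤ) - M) (M - 1 - b)) := by
    intro b hb
    have hb := Finset.mem_range.mp hb
    apply sum_ind _ _ _ _ hp
    · omega
    · omega
  unfold wt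
  rw [Finset.sum_congr rfl hin, two_mul, Finset.sum_range_add, ← Finset.sum_range_reflect,
    ← Finset.sum_add_distrib]
  have : ∀ i ∈ Finset.range M,
      (((M - 1 - i : ℕ) : ℤ) + M - max (p : ℤ) (max (((M - 1 - i : ℕ) : ℤ) - M) (M - 1 - (M - 1 - i : ℕ))))
      + (((M + i : ℕ) : ℤ) + M - max (p : ℤ) (max (((M + i : ℕ) : ℤ) - M) (M - 1 - (M + i : ℕ))))
      = (4 * M - 1) - 2 * max (p : ℤ) i := by
    intro i hi
    have hi := Finset.mem_range.mp hi
    omega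
  rw [Finset.sum_congr rfl this, Finset.sum_sub_distrib, ← Finset.mul_sum, sum_max M p hpM, hpp]
  simp
  ring

lemma sum_innerJ (x : ℤ) (hx : 0 ≤ x) (g : ℝ → ℂ) :
    HasSum (fun k : ℤ => (ind x k : ℂ) * g ((k : ℝ) + 1 / 2))
      (∑ j ∈ Finset.range ((2 * x + 1).toNat + 1),
        g (((2 * (j : ℤ) - (2 * x + 1) : ℤ) : ℝ) / 2)) := by
  have e : ∑ j ∈ Finset.range ((2 * x + 1).toNat + 1),
        g (((2 * (j : ℤ) - (2 * x + 1) : ℤ) : ℝ) / 2)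
      = ∑ k ∈ Finset.Ico (-(x + 1)) (x + 1), (ind x k : ℂ) * g ((k : ℝ) + 1 / 2) := by
    refine Finset.sum_bij (fun j _ => (j : ℤ) - (x + 1)) ?_ ?_ ?_ ?_
    · intro j hj; have := Finset.mem_range.mp hj; rw [Finset.mem_Ico]; omega
    · intro i _ j _ h; omega
    · intro k hk
      have := Finset.mem_Ico.mp hk
      exact ⟨(k + x + 1).toNat, Finset.mem_range.mpr (by omega), by omega⟩
    · intro j hj
      have := Finset.mem_range.mp hj
      have : ind x ((j : ℤ) - (x + 1)) = 1 := by unfold ind; rw [if_pos]; omega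
      rw [this, Int.cast_one, one_mul]
      congr 1
      push_cast
      ring
  rw [e]
  apply hasSum_sum_of_ne_finset_zero
  intro k hk
  rw [Finset.mem_Ico] at hk
  unfold ind
  rw [if_neg hk]
  simp

lemma filter_eq (M b : ℕ) (hb : b < 2 * M) :
    (Finset.Icc |2 * (b : ℤ) - (2 * M : ℕ) + 1| (2 * b + (2 * M : ℕ) - 1)).filter
      (fun c : ℤ => Odd (c + (2 * M : ℕ)))
    = (Finset.Ico (max ((b : ℤ) - M) (M - 1 - b)) (b + M)).image (fun x => 2 * x + 1) := by
  ext c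
  simp only [Finset.mem_filter, Finset.mem_Icc, Finset.mem_image, Finset.mem_Ico, abs_le]
  constructor
  · rintro ⟨⟨⟨h1, h2⟩, h3⟩, ⟨d, hd⟩⟩
    exact ⟨d - M, by push_cast at *; omega, by push_cast at *; omega⟩
  · rintro ⟨x, ⟨h1, h2⟩, rfl⟩
    refine ⟨by push_cast; omega, ⟨x + M, by push_cast; ring⟩⟩

lemma sum_all (M : ℕ) (g : ℝ → ℂ) :
    HasSum (fun k : ℤ => (wt M k : ℂ) * g ((k : ℝ) + 1 / 2))
    (∑ b ∈ Finset.range (2 * M),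
      ∑ c ∈ (Finset.Icc |2 * (b : ℤ) - (2 * M : ℕ) + 1| (2 * b + (2 * M : ℕ) - 1)).filter
        (fun c : ℤ => Odd (c + (2 * M : ℕ))),
        ∑ j ∈ Finset.range (c.toNat + 1), g (((2 * (j : ℤ) - c : ℤ) : ℝ) / 2)) := by
  have e : (fun k : ℤ => (wt M k : ℂ) * g ((k : ℝ) + 1 / 2))
      = fun k : ℤ => ∑ b ∈ Finset.range (2 * M),
        ∑ x ∈ Finset.Ico (max ((b : ℤ) - M) (M - 1 - b)) (b + M),
          (ind x k : ℂ) * g ((k : ℝ) + 1 / 2) := by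
    funext k
    unfold wt
    push_cast
    simp only [Finset.sum_mul]
  rw [e]
  refine hasSum_sum fun b hb => ?_
  rw [filter_eq M b (Finset.mem_range.mp hb), Finset.sum_image (by intro x _ y _ h; simp only at h; omega)]
  refine hasSum_sum fun x hx => ?_
  have := Finset.mem_Ico.mp hx
  exact sum_innerJ x (by omega) g

lemma norm_wt_sub (M : ℕ) (k : ℤ) :
    ‖(wt M k : ℂ) - 3 * (M : ℂ) ^ 2‖ ≤ 9 * (2 * (k : ℝ) + 1) ^ 2 := by
  have h : |wt M k - 3 * (M : ℤ) ^ 2| ≤ 9 * (2 * k + 1) ^ 2 := by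
    by_cases hk : -(M : ℤ) ≤ k ∧ k < M
    · rw [wt_eq M k hk.1 hk.2, abs_le]
      constructor <;> nlinarith [sq_nonneg (2 * k + 1)]
    · have h1 := wt_nonneg M k
      have h2 := wt_le M k
      have h3 : (M : ℤ) ^ 2 ≤ (2 * k + 1) ^ 2 := by
        apply sq_le_sq.mpr
        rw [abs_of_nonneg (by positivity : (0 : ℤ) ≤ M)]
        rcases abs_cases (2 * k + 1) with h | h <;> omega
      rw [abs_le]
      constructor <;> nlinarith
  have e : (wt M k : ℂ) - 3 * (M : ℂ) ^ 2 = ((wt M k - 3 * (M : ℤ) ^ 2 : ℤ) : ℂ) := by push_cast; ring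
  rw [e, Complex.norm_intCast]
  exact_mod_cast h

/-- `G k`. -/
noncomputable def GG (s t n m : ℤ) (τ : ℂ) (k : ℤ) : ℂ :=
  thA s t (s * t - n * t - m * s) τ k - thA s t (s * t - n * t + m * s) τ (-1 - k)

lemma summable_GG (s t n m : ℤ) (hs : 0 < s) (ht : 0 < t) (τ : ℂ) (hτ : 0 < τ.im) :
    Summable fun k : ℤ => (2 * (k : ℝ) + 1) ^ 2 * ‖GG s t n m τ k‖ := by
  have hA := summable_thA_norm s t (s * t - n * t - m * s) hs ht τ hτ
  have hB := summable_thA_norm s t (s * t - n * t + m * s) hs ht τ hτ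
  have hB' := (Equiv.subLeft (-1 : ℤ)).summable_iff.mpr hB
  refine Summable.of_nonneg_of_le (fun k => by positivity) (fun k => ?_) (hA.add hB')
  have : (2 * (((-1 - k : ℤ)) : ℝ) + 1) ^ 2 = (2 * (k : ℝ) + 1) ^ 2 := by push_cast; ring
  simp only [Function.comp, Equiv.subLeft_apply, this, ← mul_add]
  exact mul_le_mul_of_nonneg_left (norm_sub_le _ _) (by positivity)

lemma J_eq (s t n m : ℤ) (hs : 0 < s) (ht : 0 < t) (τ : ℂ) (hτ : 0 < τ.im) (M : ℕ) (hM : 0 < M) :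
    Q τ ((((m * s) ^ 2 + (n * t) ^ 2 : ℤ) : ℝ) / (4 * s * t) - ((2 * M : ℕ) : ℝ) / 2)
      * J' s t n m (2 * M) τ
    = (Q τ (2 * M) - 1)⁻¹ * ∑' k, (wt M k : ℂ) * GG s t n m τ k := by
  have hs' : (s : ℝ) ≠ 0 := by exact_mod_cast hs.ne'
  have ht' : (t : ℝ) ≠ 0 := by exact_mod_cast ht.ne'
  unfold J'
  have h := (sum_all M (fun r : ℝ =>
            Q τ (((s * t : ℤ) : ℝ) * r ^ 2 - ((m * s + n * t : ℤ) : ℝ) * r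
                + ((m * n : ℤ) : ℝ) / 2)
              - Q τ (((s * t : ℤ) : ℝ) * r ^ 2 - ((m * s - n * t : ℤ) : ℝ) * r
                - ((m * n : ℤ) : ℝ) / 2))).tsum_eq
  rw [← h]
  have e1 : Q τ (((2 * M : ℕ) : ℝ) / 2) - Q τ (-(((2 * M : ℕ) : ℝ) / 2))
      = Q τ (-(((2 * M : ℕ) : ℝ) / 2)) * (Q τ (2 * M) - 1) := by
    rw [mul_sub, ← Q_add, mul_one]
    congr 2
    push_cast
    ring
  have hQ : Q τ (-(((2 * M : ℕ) : ℝ) / 2)) ≠ 0 := Complex.exp_ne_zero _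
  rw [e1, mul_inv, sub_eq_add_neg, Q_add]
  have e2 : ∀ X Y Z W : ℂ, X ≠ 0 → Z * X * (X⁻¹ * Y * W) = Y * (Z * W) := by
    intro X Y Z W hX; field_simp
  rw [e2 _ _ _ _ hQ, ← tsum_mul_left]
  congr 1
  refine tsum_congr fun k => ?_
  rw [mul_left_comm, mul_sub, ← Q_add, ← Q_add]
  unfold GG thA
  congr 3
  · congr 1
    push_cast
    field_simp
    ring
  · congr 1
    push_cast
    field_simp
    ring

lemma tendsto_Q (τ : ℂ) (hτ : 0 < τ.im) (d : ℕ) :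
    Tendsto (fun M : ℕ => (M : ℂ) ^ d * Q τ (2 * M)) atTop (nhds 0) := by
  rw [tendsto_zero_iff_norm_tendsto_zero]
  have hr : Real.exp (-(4 * Real.pi * τ.im)) < 1 := by
    rw [Real.exp_lt_one_iff]
    have := Real.pi_pos
    have : 0 < 4 * Real.pi * τ.im := by positivity
    linarith
  have := tendsto_pow_const_mul_const_pow_of_lt_one d (Real.exp_pos _).le hr
  refine this.congr fun M => ?_
  rw [norm_mul, norm_pow, Complex.norm_natCast, norm_Q, ← Real.exp_nat_mul]
  congr 2
  ring

lemma main_lim (s t n m : ℤ) (hs : 0 < s) (ht : 0 < t) (hst : IsCoprime s t)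
    (hn : 0 < n) (hns : n < s) (hm : 0 < m) (hmt : m < t)
    (τ : ℂ) (hτ : 0 < τ.im) :
    Tendsto (fun M : ℕ => (Q τ (2 * M) - 1)⁻¹ * ∑' k, (wt M k : ℂ) * GG s t n m τ k
      + 3 * (M : ℂ) ^ 2 * Phi s t (s - n) m τ) atTop
      (nhds (∑' k : ℤ, (k : ℂ) * ((k : ℂ) + 1) *
        (thA s t (s * t - n * t - m * s) τ k - thA s t (s * t - n * t + m * s) τ k))) := by
  have hG := summable_GG s t n m hs ht τ hτ
  have hA1 := summable_mul_thA s t (s * t - n * t - m * s) hs ht τ hτ (fun _ => 1)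
      (fun k => by simpa using one_le_odd_sq k)
  have hB1 := summable_mul_thA s t (s * t - n * t + m * s) hs ht τ hτ (fun _ => 1)
      (fun k => by simpa using one_le_odd_sq k)
  have hA2 := summable_mul_thA s t (s * t - n * t - m * s) hs ht τ hτ _ norm_kk
  have hB2 := summable_mul_thA s t (s * t - n * t + m * s) hs ht τ hτ _ norm_kk
  have hPhi : Phi s t (s - n) m τ = ∑' k, GG s t n m τ k := by
    rw [Phi_eq s t n m hs ht hst hn hns hm hmt τ hτ]
    have := tsum_reflect _ _ (fun _ => 1) (fun _ => rfl) hA1 hB1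
    simp only [one_mul] at this hA1 hB1
    unfold GG
    rw [this, hA1.tsum_sub hB1]
  have hR := tsum_reflect _ _ _ (fun k => by push_cast; ring) hA2 hB2
  rw [← hR]
  have hGs : Summable (GG s t n m τ) := by
    refine Summable.of_norm_bounded hG fun k => ?_
    exact le_mul_of_one_le_left (norm_nonneg _) (one_le_odd_sq k)
  have hv : Tendsto (fun M : ℕ => ∑' k, ((wt M k : ℂ) - 3 * (M : ℂ) ^ 2) * GG s t n m τ k) atTop
      (nhds (∑' k : ℤ, (-((k : ℂ) * ((k : ℂ) + 1))) * GG s t n m τ k)) := by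
    refine tendsto_tsum_of_dominated_convergence (hG.mul_left 9) (fun k => ?_)
      (Eventually.of_forall fun M k => ?_)
    · refine tendsto_const_nhds.congr' ?_
      filter_upwards [eventually_ge_atTop (k.natAbs + 1)] with M hM
      rw [wt_eq M k (by omega) (by omega)]
      push_cast
      ring
    · rw [norm_mul, ← mul_assoc]
      exact mul_le_mul_of_nonneg_right (norm_wt_sub M k) (norm_nonneg _)
  have hvs : ∀ M : ℕ, Summable fun k => ((wt M k : ℂ) - 3 * (M : ℂ) ^ 2) * GG s t n m τ k := by
    intro M
    refine Summable.of_norm_bounded (hG.mul_left 9) fun k => ?_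
    rw [norm_mul, ← mul_assoc]
    exact mul_le_mul_of_nonneg_right (norm_wt_sub M k) (norm_nonneg _)
  have hq0 : Tendsto (fun M : ℕ => Q τ (2 * M)) atTop (nhds 0) := by
    simpa using tendsto_Q τ hτ 0
  have hinv : Tendsto (fun M : ℕ => (Q τ (2 * M) - 1)⁻¹) atTop (nhds (-1)) := by
    have := (hq0.sub_const 1).inv₀ (by norm_num)
    simpa using this
  have hfin := (hinv.mul hv).add
    (((tendsto_Q τ hτ 2).mul hinv).mul_const (3 * Phi s t (s - n) m τ))
  have e : (-1 : ℂ) * (∑' k : ℤ, (-((k : ℂ) * ((k : ℂ) + 1))) * GG s t n m τ k)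
      + 0 * (-1) * (3 * Phi s t (s - n) m τ)
      = ∑' k : ℤ, ((k : ℂ) * ((k : ℂ) + 1)) * (thA s t (s * t - n * t - m * s) τ k
        - thA s t (s * t - n * t + m * s) τ (-1 - k)) := by
    simp only [neg_mul, tsum_neg]
    unfold GG
    ring
  rw [e] at hfin
  refine hfin.congr' ?_
  filter_upwards [eventually_ge_atTop 1] with M hM
  have hne : Q τ (2 * M) - 1 ≠ 0 := by
    intro h
    have h1 : Q τ (2 * M) = 1 := sub_eq_zero.mp h
    have h2 := norm_Q τ (2 * M)
    rw [h1, norm_one] at h2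
    have : 0 < 2 * Real.pi * τ.im * (2 * (M : ℝ)) := by
      have := Real.pi_pos
      have : (0 : ℝ) < M := by exact_mod_cast hM
      positivity
    have h3 := Real.exp_lt_one_iff.mpr (neg_neg_of_pos this)
    linarith
  have hsplit : ∑' k, (wt M k : ℂ) * GG s t n m τ k
      = ∑' k, ((wt M k : ℂ) - 3 * (M : ℂ) ^ 2) * GG s t n m τ k
        + 3 * (M : ℂ) ^ 2 * Phi s t (s - n) m τ := by
    rw [hPhi, ← tsum_mul_left, ← (hvs M).tsum_add (hGs.mul_left _)]
    exact tsum_congr fun k => by ring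
  rw [hsplit]
  field_simp
  ring

theorem statement10 (s t n m : ℤ) (hs : 0 < s) (ht : 0 < t) (hst : IsCoprime s t)
    (hn : 0 < n) (hns : n < s) (hm : 0 < m) (hmt : m < t)
    (τ : ℂ) (hτ : 0 < τ.im) :
    Tendsto (fun k : ℕ =>
        Q τ ((((m * s) ^ 2 + (n * t) ^ 2 : ℤ) : ℝ) / (4 * s * t) - ((2 * k + 2 : ℕ) : ℝ) / 2)
            * J' s t n m (2 * k + 2) τ
          + ((3 * ((2 * k + 2 : ℕ) : ℂ) ^ 2) / 4) * Phi s t (s - n) m τ)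
      atTop
      (nhds (∑' k : ℤ, (k : ℂ) * ((k : ℂ) + 1) *
        (Q τ (((2 * s * t * k + s * t - n * t - m * s : ℤ) : ℝ) ^ 2 / (4 * s * t))
          - Q τ (((2 * s * t * k + s * t - n * t + m * s : ℤ) : ℝ) ^ 2 / (4 * s * t))))) := by

  have h := (main_lim s t n m hs ht hst hn hns hm hmt τ hτ).comp (tendsto_add_atTop_nat 1)
  have e : ∀ k : ℤ, (k : ℂ) * ((k : ℂ) + 1) *
        (Q τ (((2 * s * t * k + s * t - n * t - m * s : ℤ) : ℝ) ^ 2 / (4 * s * t))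
          - Q τ (((2 * s * t * k + s * t - n * t + m * s : ℤ) : ℝ) ^ 2 / (4 * s * t)))
      = (k : ℂ) * ((k : ℂ) + 1) *
        (thA s t (s * t - n * t - m * s) τ k - thA s t (s * t - n * t + m * s) τ k) := by
    intro k
    unfold thA
    congr 5 <;> push_cast <;> ring
  rw [tsum_congr e]
  refine h.congr fun k => ?_
  simp only [Function.comp]
  rw [← J_eq s t n m hs ht τ hτ (k + 1) (by omega)]
  have e2 : 2 * k + 2 = 2 * (k + 1) := by ring
  rw [e2]
  congr 2
  push_cast
  ring
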